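/- Let α₁ = (a₁, ℓ₁), α₂ = (a₂, ℓ₂), β₂ = (b₂, m₂), β₃ = (b₃, m₃), where a₁, a₂, b₂, b₃ are real numbers and ℓ₁, ℓ₂, m₂, m₃ are positive integers. If max(P(α₁, β₂), P(α₂, β₃)) ≤ min(P(α₂, β₂), P(α₁, β₃)), then P(α₁, β₂) = P(α₂, β₃) = P(α₂, β₂) = P(α₁, β₃). -/

import Mathlib

/-- For a pair `α = (a, ℓ)` consisting of a real number `a` and a (positive)
integer `ℓ`, and a pair `β = (b, m)` consisting of a real number `b` and a
(positive) integer `m`, `P (α, β) = (a·m + b·ℓ)/(ℓ + m)`. -/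
noncomputable def P (α β : ℝ × ℕ) : ℝ :=
  (α.1 * (β.2 : ℝ) + β.1 * (α.2 : ℝ)) / ((α.2 : ℝ) + (β.2 : ℝ))

/-- `I' (α, β) = (b − a)/(ℓ + m)`. -/
noncomputable def I' (α β : ℝ × ℕ) : ℝ :=
  (β.1 - α.1) / ((α.2 : ℝ) + (β.2 : ℝ))

theorem P_sub_eq_mul (a b t : ℝ) {l m : ℕ} (hl : 0 < l) (hm : 0 < m) :
    P (a, l) (b, m) - t = (l * m / (l + m) : ℝ) * ((a - t) / l + (b - t) / m) := by
  have hl' : (0 : ℝ) < l := by exact_mod_cast hl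
  have hm' : (0 : ℝ) < m := by exact_mod_cast hm
  simp only [P]
  field_simp
  ring

theorem P_le_iff (a b t : ℝ) {l m : ℕ} (hl : 0 < l) (hm : 0 < m) :
    P (a, l) (b, m) ≤ t ↔ (a - t) / l + (b - t) / m ≤ 0 := by
  have hc : (0 : ℝ) < l * m / (l + m) := by positivity
  rw [← sub_nonpos, P_sub_eq_mul a b t hl hm, ← neg_nonneg, ← mul_neg,
    mul_nonneg_iff_of_pos_left hc, neg_nonneg]

theorem le_P_iff (a b t : ℝ) {l m : ℕ} (hl : 0 < l) (hm : 0 < m) :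
    t ≤ P (a, l) (b, m) ↔ 0 ≤ (a - t) / l + (b - t) / m := by
  have hc : (0 : ℝ) < l * m / (l + m) := by positivity
  rw [← sub_nonneg, P_sub_eq_mul a b t hl hm, mul_nonneg_iff_of_pos_left hc]

/-- For `α₁ = (a₁, ℓ₁)`, `α₂ = (a₂, ℓ₂)`, `β₂ = (b₂, m₂)`,
`β₃ = (b₃, m₃)` with `a₁, a₂, b₂, b₃` real and `ℓ₁, ℓ₂, m₂, m₃` positive
integers, if `max (P(α₁,β₂)) (P(α₂,β₃)) ≤ min (P(α₂,β₂)) (P(α₁,β₃))` then all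
four quantities are equal. -/
theorem algebraic_simplification (a₁ a₂ b₂ b₃ : ℝ) (l₁ l₂ m₂ m₃ : ℕ)
    (hl₁ : 0 < l₁) (hl₂ : 0 < l₂) (hm₂ : 0 < m₂) (hm₃ : 0 < m₃)
    (h : max (P (a₁, l₁) (b₂, m₂)) (P (a₂, l₂) (b₃, m₃)) ≤
      min (P (a₂, l₂) (b₂, m₂)) (P (a₁, l₁) (b₃, m₃))) :
    P (a₁, l₁) (b₂, m₂) = P (a₂, l₂) (b₃, m₃) ∧
    P (a₂, l₂) (b₃, m₃) = P (a₂, l₂) (b₂, m₂) ∧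
    P (a₂, l₂) (b₂, m₂) = P (a₁, l₁) (b₃, m₃) := by
  obtain ⟨t, ht, ht'⟩ : ∃ t, max (P (a₁, l₁) (b₂, m₂)) (P (a₂, l₂) (b₃, m₃)) ≤ t ∧
      t ≤ min (P (a₂, l₂) (b₂, m₂)) (P (a₁, l₁) (b₃, m₃)) := ⟨_, le_rfl, h⟩
  obtain ⟨h₁₂, h₂₃⟩ := max_le_iff.mp ht
  obtain ⟨h₂₂, h₁₃⟩ := le_min_iff.mp ht'
  have k₁₂ := (P_le_iff a₁ b₂ t hl₁ hm₂).mp h₁₂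
  have k₂₃ := (P_le_iff a₂ b₃ t hl₂ hm₃).mp h₂₃
  have k₂₂ := (le_P_iff a₂ b₂ t hl₂ hm₂).mp h₂₂
  have k₁₃ := (le_P_iff a₁ b₃ t hl₁ hm₃).mp h₁₃
  have e₁₂ := h₁₂.antisymm ((le_P_iff a₁ b₂ t hl₁ hm₂).mpr (by linarith))
  have e₂₃ := h₂₃.antisymm ((le_P_iff a₂ b₃ t hl₂ hm₃).mpr (by linarith))
  have e₂₂ := h₂₂.antisymm' ((P_le_iff a₂ b₂ t hl₂ hm₂).mpr (by linarith))
  have e₁₃ := h₁₃.antisymm' ((P_le_iff a₁ b₃ t hl₁ hm₃).mpr (by linarith))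
  exact ⟨e₁₂.trans e₂₃.symm, e₂₃.trans e₂₂.symm, e₂₂.trans e₁₃.symm⟩
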